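/- Let G be a complete multipartite graph whose vertex set is partitioned into parts such that at least two of the parts have cardinality at least 2 (two vertices are adjacent if and only if they lie in different parts). Then G admits no admissible weight system. -/

import Mathlib

/-- A subset `S` of the vertices of a simple graph `G` is a *tube* if the
subgraph of `G` induced on `S` is (nonempty and) connected. -/
def IsTube {V : Type*} (G : SimpleGraph V) (S : Finset V) : Prop :=
  (G.induce (S : Set V)).Connected

/-- A subset `D` of the vertices of a simple graph `G` is a *non-tube* if `D`
is nonempty and the subgraph of `G` induced on `D` is not connected. -/
def IsNonTube {V : Type*} (G : SimpleGraph V) (D : Finset V) : Prop :=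
  D.Nonempty ∧ ¬ (G.induce (D : Set V)).Connected

/-- An *admissible weight system* for `G` is a pair `(c₀, c)` with values in
`(0,1]` such that (W1) for every nontrivial tube `T`, `c₀ + ∑_{v ∈ T} c v > 1`,
and (W2) for every non-tube `D`, `c₀ + ∑_{v ∈ D} c v ≤ 1`. -/
def IsAdmissible {V : Type*} (G : SimpleGraph V) (c₀ : ℝ) (c : V → ℝ) : Prop :=
  (0 < c₀ ∧ c₀ ≤ 1) ∧ (∀ v, 0 < c v ∧ c v ≤ 1) ∧
  (∀ T : Finset V, IsTube G T → 2 ≤ T.card → 1 < c₀ + ∑ v ∈ T, c v) ∧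
  (∀ D : Finset V, IsNonTube G D → c₀ + ∑ v ∈ D, c v ≤ 1)

theorem isTube_pair_of_adj {V : Type*} [DecidableEq V] {G : SimpleGraph V} {u v : V}
    (h : G.Adj u v) : IsTube G {u, v} := by
  rw [IsTube, Finset.coe_pair]
  exact SimpleGraph.induce_pair_connected_of_adj h

theorem isNonTube_pair_of_not_adj {V : Type*} [DecidableEq V] {G : SimpleGraph V} {u v : V}
    (hne : u ≠ v) (h : ¬ G.Adj u v) : IsNonTube G {u, v} := by
  refine ⟨Finset.insert_nonempty _ _, fun hc => ?_⟩
  have : Nontrivial ((({u, v} : Finset V) : Set V)) :=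
    ⟨⟨u, by simp⟩, ⟨v, by simp⟩, by simpa using hne⟩
  obtain ⟨⟨w, hw⟩, hadj⟩ :=
    hc.preconnected.exists_adj_of_nontrivial ⟨u, by simp⟩
  rw [SimpleGraph.comap_adj] at hadj
  obtain rfl | rfl : w = u ∨ w = v := by simpa using hw
  · exact G.irrefl hadj
  · exact h hadj

/-- A graph with an alternating 4-cycle (edges `a a'`, `b b'` and non-edges `a b`, `a' b'`)
admits no admissible weight system. -/
theorem IsAdmissible.false_of_alternating_cycle {V : Type*} {G : SimpleGraph V} {c₀ : ℝ}
    {c : V → ℝ} (hc : IsAdmissible G c₀ c) {a b a' b' : V} (hab : a ≠ b) (ha'b' : a' ≠ b')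
    (hnab : ¬ G.Adj a b) (hna'b' : ¬ G.Adj a' b') (haa' : G.Adj a a') (hbb' : G.Adj b b') :
    False := by
  classical
  obtain ⟨-, -, tube, nonTube⟩ := hc
  have h₁ := nonTube _ (isNonTube_pair_of_not_adj hab hnab)
  have h₂ := nonTube _ (isNonTube_pair_of_not_adj ha'b' hna'b')
  have h₃ := tube _ (isTube_pair_of_adj haa') (Finset.card_pair haa'.ne).ge
  have h₄ := tube _ (isTube_pair_of_adj hbb') (Finset.card_pair hbb'.ne).ge
  rw [Finset.sum_pair hab] at h₁
  rw [Finset.sum_pair ha'b'] at h₂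
  rw [Finset.sum_pair haa'.ne] at h₃
  rw [Finset.sum_pair hbb'.ne] at h₄
  linarith

/-- A complete multipartite graph (vertices adjacent iff they lie in different
parts, the parts being the fibers of `f`) in which at least two parts have
cardinality at least `2` admits no admissible weight system. -/
theorem completeMultipartite_not_admissible {V ι : Type*} [Fintype V]
    (f : V → ι) (G : SimpleGraph V)
    (hG : ∀ x y, G.Adj x y ↔ f x ≠ f y)
    (a b a' b' : V) (hab : a ≠ b) (hfab : f a = f b)
    (ha'b' : a' ≠ b') (hfa'b' : f a' = f b') (hdiff : f a ≠ f a') :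
    ¬ ∃ (c₀ : ℝ) (c : V → ℝ), IsAdmissible G c₀ c := by
  rintro ⟨c₀, c, hc⟩
  refine hc.false_of_alternating_cycle hab ha'b' ?_ ?_ ((hG a a').2 hdiff) ((hG b b').2 ?_)
  · simp [hG, hfab]
  · simp [hG, hfa'b']
  · rwa [← hfab, ← hfa'b']
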